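/- If T is a finite forest (a finite simple graph with no cycles), then the family Ψ(T) of local maximum stable sets of T forms a greedoid on the vertex set of T. -/

import Mathlib

open Classical

variable {V : Type*} [Fintype V] [DecidableEq V]

/-- `S` is a stable (independent) set of vertices in `G`. -/
def IsStable (G : SimpleGraph V) (S : Finset V) : Prop :=
  ∀ ⦃x⦄, x ∈ S → ∀ ⦃y⦄, y ∈ S → ¬G.Adj x y

/-- The open neighborhood `N(S)`: vertices outside `S` having a neighbor in `S`. -/
noncomputable def nbhd (G : SimpleGraph V) (S : Finset V) : Finset V :=
  Finset.univ.filter fun v => v ∉ S ∧ ∃ u ∈ S, G.Adj u v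

/-- The closed neighborhood `N[S] = S ∪ N(S)`. -/
noncomputable def closedNbhd (G : SimpleGraph V) (S : Finset V) : Finset V :=
  S ∪ nbhd G S

/-- The stability (independence) number of the subgraph of `G` induced by `A`. -/
noncomputable def alphaOn (G : SimpleGraph V) (A : Finset V) : ℕ :=
  sSup {n | ∃ S ⊆ A, IsStable G S ∧ S.card = n}

/-- The stability (independence) number `α(G)`. -/
noncomputable def alpha (G : SimpleGraph V) : ℕ :=
  alphaOn G Finset.univ

/-- `S` is a maximum stable set of the subgraph of `G` induced by `N[S]`. -/
def IsLocalMaxStable (G : SimpleGraph V) (S : Finset V) : Prop :=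
  IsStable G S ∧ S.card = alphaOn G (closedNbhd G S)

/-- `Ψ(G)`: the family of all local maximum stable sets of `G`. -/
def Psi (G : SimpleGraph V) : Set (Finset V) :=
  {S | IsLocalMaxStable G S}

/-- A matching of `G`: a set of pairwise disjoint edges of `G`. -/
def IsGMatching (G : SimpleGraph V) (M : Finset (Sym2 V)) : Prop :=
  (∀ e ∈ M, e ∈ G.edgeSet) ∧
    ∀ e ∈ M, ∀ f ∈ M, e ≠ f → ∀ v : V, v ∈ e → v ∉ f

/-- A matching of `G` all of whose edges have both endpoints inside `A`,
i.e. a matching of the subgraph of `G` induced by `A`. -/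
def IsGMatchingOn (G : SimpleGraph V) (A : Finset V) (M : Finset (Sym2 V)) : Prop :=
  IsGMatching G M ∧ ∀ e ∈ M, ∀ v : V, v ∈ e → v ∈ A

/-- The matching number of the subgraph of `G` induced by `A`. -/
noncomputable def muOn (G : SimpleGraph V) (A : Finset V) : ℕ :=
  sSup {n | ∃ M, IsGMatchingOn G A M ∧ M.card = n}

/-- The matching number `μ(G)`. -/
noncomputable def mu (G : SimpleGraph V) : ℕ :=
  muOn G Finset.univ

/-- A maximum matching of `G`. -/
def IsMaximumGMatching (G : SimpleGraph V) (M : Finset (Sym2 V)) : Prop :=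
  IsGMatching G M ∧ M.card = mu G

/-- The matching `M` saturates the vertex `v`. -/
def MSaturates (M : Finset (Sym2 V)) (v : V) : Prop :=
  ∃ e ∈ M, v ∈ e

/-- A perfect matching of `G`: a matching saturating every vertex. -/
def IsPerfectGMatching (G : SimpleGraph V) (M : Finset (Sym2 V)) : Prop :=
  IsGMatching G M ∧ ∀ v : V, MSaturates M v

/-- The set of vertices saturated by `M`. -/
noncomputable def msupp (M : Finset (Sym2 V)) : Finset V :=
  Finset.univ.filter fun v => ∃ e ∈ M, v ∈ e

/-- `M` is a uniquely restricted matching: it is the unique perfect matching of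
the subgraph of `G` induced by the set of vertices saturated by `M`. -/
def UniquelyRestricted (G : SimpleGraph V) (M : Finset (Sym2 V)) : Prop :=
  IsGMatching G M ∧
    ∀ M' : Finset (Sym2 V), IsGMatchingOn G (msupp M) M' →
      (∀ v ∈ msupp M, MSaturates M' v) → M' = M

/-- Accessibility property of a set system. -/
def AccessibleFam (F : Set (Finset V)) : Prop :=
  ∀ X ∈ F, X ≠ ∅ → ∃ x ∈ X, X.erase x ∈ F

/-- Exchange property of a set system. -/
def ExchangeFam (F : Set (Finset V)) : Prop :=
  ∀ X ∈ F, ∀ Y ∈ F, X.card = Y.card + 1 → ∃ x ∈ X, x ∉ Y ∧ insert x Y ∈ F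

/-- A greedoid: a nonempty set system satisfying accessibility and exchange. -/
def IsGreedoidFam (F : Set (Finset V)) : Prop :=
  F.Nonempty ∧ AccessibleFam F ∧ ExchangeFam F

/-- A maximal stable set. -/
def IsMaximalStable (G : SimpleGraph V) (S : Finset V) : Prop :=
  IsStable G S ∧ ∀ T, IsStable G T → S ⊆ T → S = T

/-- `G` is well-covered: all maximal stable sets have the same cardinality. -/
def WellCovered (G : SimpleGraph V) : Prop :=
  ∀ S T, IsMaximalStable G S → IsMaximalStable G T → S.card = T.card

/-- `G` is very well-covered: well-covered, no isolated vertices, `|V| = 2α(G)`. -/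
def VeryWellCovered (G : SimpleGraph V) : Prop :=
  WellCovered G ∧ (∀ v : V, ∃ u, G.Adj v u) ∧ Fintype.card V = 2 * alpha G

/-- The subgraph of `G` induced by `A` is a König-Egerváry graph. -/
def KonigEgervaryOn (G : SimpleGraph V) (A : Finset V) : Prop :=
  alphaOn G A + muOn G A = A.card

/-- `G` is a König-Egerváry graph: `α(G) + μ(G) = |V(G)|`. -/
def KonigEgervary (G : SimpleGraph V) : Prop :=
  alpha G + mu G = Fintype.card V

/-- The cycle `c` is alternating with respect to `M`: of every two incident
edges of `c` exactly one belongs to `M`. -/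
def IsAlternatingCycle (G : SimpleGraph V) (M : Finset (Sym2 V)) {v : V}
    (c : G.Walk v v) : Prop :=
  c.IsCycle ∧ ∀ e ∈ c.edges, ∀ f ∈ c.edges, e ≠ f →
    (∃ u : V, u ∈ e ∧ u ∈ f) → (e ∈ M ↔ f ∉ M)

/-- `G` contains an `M`-alternating cycle. -/
def HasAlternatingCycle (G : SimpleGraph V) (M : Finset (Sym2 V)) : Prop :=
  ∃ (v : V) (c : G.Walk v v), IsAlternatingCycle G M c

/-- The cycle `c` is chordless: the subgraph induced by its vertices has no
edges other than the cycle edges. -/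
def ChordlessCycle (G : SimpleGraph V) {v : V} (c : G.Walk v v) : Prop :=
  ∀ x ∈ c.support, ∀ y ∈ c.support, G.Adj x y → s(x, y) ∈ c.edges

theorem isLocalMaxStable_iff (G : SimpleGraph V) (S : Finset V) :
    IsLocalMaxStable G S ↔
      IsStable G S ∧ ∀ A ⊆ closedNbhd G S, IsStable G A → A.card ≤ S.card := by
  have bdd : BddAbove {n | ∃ A ⊆ closedNbhd G S, IsStable G A ∧ A.card = n} :=
    ⟨Fintype.card V, by rintro _ ⟨A, -, -, rfl⟩; exact Finset.card_le_univ A⟩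
  refine and_congr_right fun hS => ⟨fun h A hA hAs => ?_, fun h => le_antisymm ?_ ?_⟩
  · rw [h]
    exact le_csSup bdd ⟨A, hA, hAs, rfl⟩
  · exact le_csSup bdd ⟨S, Finset.subset_union_left, hS, rfl⟩
  · refine csSup_le ⟨_, S, Finset.subset_union_left, hS, rfl⟩ ?_
    rintro _ ⟨A, hA, hAs, rfl⟩
    exact h A hA hAs

theorem mem_nbhd {G : SimpleGraph V} {S : Finset V} {v : V} :
    v ∈ nbhd G S ↔ v ∉ S ∧ ∃ u ∈ S, G.Adj u v := by
  simp [nbhd]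

/-- `f` matches the neighborhood of `S` into `S`. -/
def MatchesNbhd (G : SimpleGraph V) (S : Finset V) (f : V → V) : Prop :=
  Set.InjOn f (nbhd G S) ∧ ∀ v ∈ nbhd G S, f v ∈ S ∧ G.Adj v (f v)

theorem MatchesNbhd.mem_psi {G : SimpleGraph V} {S : Finset V} {f : V → V}
    (hf : MatchesNbhd G S f) (hS : IsStable G S) : S ∈ Psi G := by
  refine (isLocalMaxStable_iff G S).2 ⟨hS, fun A hA hAs => ?_⟩
  have key : ∀ a ∈ A, a ∉ S → a ∈ nbhd G S := fun a ha haS =>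
    (Finset.mem_union.1 (hA ha)).resolve_left haS
  refine Finset.card_le_card_of_injOn (fun a => if a ∈ S then a else f a) ?_ ?_
  · intro a ha
    by_cases haS : a ∈ S
    · simp [haS]
    · simpa [haS] using (hf.2 a (key a ha haS)).1
  · intro a ha b hb hab
    by_cases haS : a ∈ S <;> by_cases hbS : b ∈ S <;> simp only [haS, hbS, if_true, if_false] at hab
    · exact hab
    · exact absurd (hab ▸ (hf.2 b (key b hb hbS)).2) (hAs hb ha)
    · exact absurd (hab ▸ (hf.2 a (key a ha haS)).2) (hAs ha hb)
    · exact hf.1 (key a ha haS) (key b hb hbS) hab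

theorem card_le_card_filter_adj_of_mem_psi {G : SimpleGraph V} {S A : Finset V} (hS : S ∈ Psi G)
    (hA : A ⊆ nbhd G S) (hAs : IsStable G A) :
    A.card ≤ (S.filter fun u => ∃ a ∈ A, G.Adj a u).card := by
  obtain ⟨hSs, hmax⟩ := (isLocalMaxStable_iff G S).1 hS
  have hdisj : Disjoint (S.filter fun u => ¬∃ a ∈ A, G.Adj a u) A :=
    Finset.disjoint_left.2 fun u hu huA =>
      (mem_nbhd.1 (hA huA)).1 (Finset.mem_filter.1 hu).1
  have h := hmax ((S.filter fun u => ¬∃ a ∈ A, G.Adj a u) ∪ A)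
    (Finset.union_subset_union (Finset.filter_subset _ _) hA) ?_
  · rw [Finset.card_union_of_disjoint hdisj] at h
    have := Finset.card_filter_add_card_filter_not (s := S) fun u => ∃ a ∈ A, G.Adj a u
    omega
  · intro x hx y hy hxy
    simp only [Finset.mem_union, Finset.mem_filter] at hx hy
    rcases hx with hx | hx <;> rcases hy with hy | hy
    · exact hSs hx.1 hy.1 hxy
    · exact hx.2 ⟨y, hy, hxy.symm⟩
    · exact hy.2 ⟨x, hx, hxy⟩
    · exact hAs hx hy hxy

theorem exists_matchesNbhd {G : SimpleGraph V} (hG : G.IsBipartite) {S : Finset V}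
    (hS : S ∈ Psi G) : ∃ f, MatchesNbhd G S f := by
  obtain ⟨c⟩ := hG
  have hall : ∀ A ⊆ nbhd G S, A.card ≤ (S.filter fun u => ∃ a ∈ A, G.Adj a u).card := by
    intro A hA
    have part : ∀ i, (A.filter fun a => c a = i).card ≤
        (S.filter fun u => ∃ a ∈ A.filter fun a => c a = i, G.Adj a u).card := fun i =>
      card_le_card_filter_adj_of_mem_psi hS ((Finset.filter_subset _ _).trans hA) <| by
        intro x hx y hy hxy
        exact c.valid hxy ((Finset.mem_filter.1 hx).2.trans (Finset.mem_filter.1 hy).2.symm)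
    rw [Finset.card_eq_sum_card_fiberwise (f := c) (t := Finset.univ) (by simp)]
    refine (Finset.sum_le_sum fun i _ => part i).trans ?_
    rw [← Finset.card_biUnion]
    · refine Finset.card_le_card fun u hu => ?_
      simp only [Finset.mem_biUnion, Finset.mem_filter] at hu ⊢
      obtain ⟨i, -, huS, a, ⟨ha, -⟩, hau⟩ := hu
      exact ⟨huS, a, ha, hau⟩
    · intro i _ j _ hij
      refine Finset.disjoint_left.2 fun u hu hu' => ?_
      simp only [Finset.mem_filter] at hu hu'
      obtain ⟨-, a, ⟨-, hai⟩, hau⟩ := hu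
      obtain ⟨-, b, ⟨-, hbj⟩, hbu⟩ := hu'
      have h1 := c.valid hau
      have h2 := c.valid hbu
      rw [hai] at h1
      rw [hbj] at h2
      omega
  obtain ⟨f, hf, hfm⟩ := (Finset.all_card_le_biUnion_card_iff_exists_injective
    fun v : nbhd G S => S.filter fun u => G.Adj v u).1 fun s => by
      have h := hall (s.map (Function.Embedding.subtype _)) (by
        intro v hv
        obtain ⟨w, -, rfl⟩ := Finset.mem_map.1 hv
        exact w.2)
      rw [Finset.card_map] at h
      refine h.trans (Finset.card_le_card fun u hu => ?_)
      simp only [Finset.mem_filter, Finset.mem_map, Finset.mem_biUnion] at hu ⊢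
      obtain ⟨huS, _, ⟨w, hw, rfl⟩, hwu⟩ := hu
      exact ⟨w, hw, huS, hwu⟩
  refine ⟨fun v => if h : v ∈ nbhd G S then f ⟨v, h⟩ else v, fun v hv w hw hvw => ?_,
    fun v hv => ?_⟩
  · rw [Finset.mem_coe] at hv hw
    simp only [hv, hw, dif_pos] at hvw
    exact congrArg Subtype.val (hf hvw)
  · simpa only [hv, dif_pos] using Finset.mem_filter.1 (hfm ⟨v, hv⟩)

theorem SimpleGraph.IsAcyclic.exists_card_filter_adj_le_one {G : SimpleGraph V} (hG : G.IsAcyclic)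
    {P Q : Finset V} (hP : P.Nonempty) (hPQ : Disjoint P Q) (hcard : Q.card ≤ P.card) :
    ∃ p ∈ P, (Q.filter fun q => G.Adj p q).card ≤ 1 := by
  by_contra! hdeg
  let W : Finset V := P ∪ Q
  have : Nonempty (W : Set V) := ⟨⟨hP.choose, Finset.mem_union_left _ hP.choose_spec⟩⟩
  obtain ⟨F, hGF, -, hF⟩ := SimpleGraph.Connected.exists_isTree_le_of_le_of_isAcyclic
    (SimpleGraph.connected_top (V := (W : Set V))) le_top (hG.induce W)
  have hFcard := hF.card_edgeFinset
  let E := P.sigma fun p => Q.filter fun q => G.Adj p q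
  have hE : 2 * P.card ≤ E.card := by
    rw [Finset.card_sigma, mul_comm]
    exact Finset.card_nsmul_le_sum P _ 2 hdeg
  have hEF : E.card ≤ (F.edgeFinset.image (Sym2.map Subtype.val)).card := by
    refine Finset.card_le_card_of_injOn (fun e => s(e.1, e.2)) ?_ ?_
    · rintro ⟨p, q⟩ h
      simp only [E, Finset.coe_sigma, Set.mem_sigma_iff, Finset.mem_coe, Finset.mem_filter] at h
      obtain ⟨hp, hq, hpq⟩ := h
      refine Finset.mem_coe.2 (Finset.mem_image.2
        ⟨s(⟨p, Finset.mem_union_left _ hp⟩, ⟨q, Finset.mem_union_right _ hq⟩), ?_, rfl⟩)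
      rw [SimpleGraph.mem_edgeFinset, SimpleGraph.mem_edgeSet]
      exact hGF hpq
    · rintro ⟨p, q⟩ h ⟨p', q'⟩ h' heq
      simp only [E, Finset.coe_sigma, Set.mem_sigma_iff, Finset.mem_coe, Finset.mem_filter] at h h'
      rcases Sym2.eq_iff.1 heq with ⟨rfl, rfl⟩ | ⟨rfl, rfl⟩
      · rfl
      · exact absurd h'.2.1 (Finset.disjoint_left.1 hPQ h.1)
  have hW : Fintype.card (W : Set V) = P.card + Q.card := by
    rw [← Finset.card_union_of_disjoint hPQ]
    simp [W]
  have := hEF.trans Finset.card_image_le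
  omega

theorem accessibleFam_psi {T : SimpleGraph V} (hT : T.IsAcyclic) : AccessibleFam (Psi T) := by
  intro X hX hne
  have hXs : IsStable T X := hX.1
  obtain ⟨f, hinj, hf⟩ := exists_matchesNbhd hT.isBipartite hX
  have hsub : ∀ x ∈ X, nbhd T (X.erase x) ⊆ nbhd T X := by
    intro x hx v hv
    obtain ⟨-, u, hu, huv⟩ := mem_nbhd.1 hv
    have hu := Finset.mem_of_mem_erase hu
    exact mem_nbhd.2 ⟨fun h => hXs hu h huv, u, hu, huv⟩
  obtain ⟨x, hx, hxf⟩ : ∃ x ∈ X, ∀ v ∈ nbhd T (X.erase x), f v ≠ x := by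
    by_cases h : ∃ x ∈ X, ∀ v ∈ nbhd T X, f v ≠ x
    · obtain ⟨x, hx, hxf⟩ := h
      exact ⟨x, hx, fun v hv => hxf v (hsub x hx hv)⟩
    · push Not at h
      have hcard : X.card ≤ (nbhd T X).card :=
        (Finset.card_le_card fun x hx => Finset.mem_image.2 (h x hx)).trans
          (Finset.card_image_le (f := f))
      obtain ⟨y, hy, hdeg⟩ := hT.exists_card_filter_adj_le_one
        (Finset.card_pos.1 ((Finset.card_pos.2 (Finset.nonempty_iff_ne_empty.2 hne)).trans_le hcard))
        (Finset.disjoint_left.2 fun v hv => (mem_nbhd.1 hv).1) hcard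
      refine ⟨f y, (hf y hy).1, fun v hv hvy => ?_⟩
      obtain rfl := hinj (hsub _ (hf y hy).1 hv) hy hvy
      obtain ⟨-, u, hu, huv⟩ := mem_nbhd.1 hv
      obtain ⟨hne, hu⟩ := Finset.mem_erase.1 hu
      exact hne (Finset.card_le_one.1 hdeg u (Finset.mem_filter.2 ⟨hu, huv.symm⟩) _
        (Finset.mem_filter.2 (hf v hy)))
  refine ⟨x, hx, MatchesNbhd.mem_psi (f := f) ⟨?_, fun v hv => ?_⟩ fun a ha b hb =>
    hXs (Finset.mem_of_mem_erase ha) (Finset.mem_of_mem_erase hb)⟩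
  · exact hinj.mono (Finset.coe_subset.2 (hsub x hx))
  · have := hf v (hsub x hx hv)
    exact ⟨Finset.mem_erase.2 ⟨hxf v hv, this.1⟩, this.2⟩

theorem exchangeFam_psi {T : SimpleGraph V} (hT : T.IsAcyclic) : ExchangeFam (Psi T) := by
  intro X hX Y hY hXY
  have hXs : IsStable T X := hX.1
  have hYs : IsStable T Y := hY.1
  obtain ⟨f, hfinj, hf⟩ := exists_matchesNbhd hT.isBipartite hX
  obtain ⟨g, hginj, hg⟩ := exists_matchesNbhd hT.isBipartite hY
  let B := X ∩ nbhd T Y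
  let P := X \ closedNbhd T Y
  let D := (nbhd T X).filter fun d => d ∉ nbhd T Y ∧ ∃ x ∈ P, T.Adj x d
  have hB : ∀ b ∈ B, g b ∈ nbhd T X ∧ g b ∈ Y := by
    intro b hb
    obtain ⟨hbX, hbY⟩ := Finset.mem_inter.1 hb
    obtain ⟨h1, h2⟩ := hg b hbY
    exact ⟨mem_nbhd.2 ⟨fun h => hXs hbX h h2, b, hbX, h2⟩, h1⟩
  have hmaps : ∀ b ∈ B, f (g b) ∈ B := by
    intro b hb
    obtain ⟨h1, h2⟩ := hB b hb
    obtain ⟨h3, h4⟩ := hf _ h1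
    exact Finset.mem_inter.2 ⟨h3, mem_nbhd.2 ⟨fun h => hYs h2 h h4, _, h2, h4⟩⟩
  have hinj : Set.InjOn (fun b => f (g b)) B := fun a ha b hb hab =>
    hginj (Finset.mem_inter.1 ha).2 (Finset.mem_inter.1 hb).2
      (hfinj (hB a ha).1 (hB b hb).1 hab)
  have hsurj := Finset.surjOn_of_injOn_of_card_le (fun b => f (g b)) hmaps hinj le_rfl
  have hPmem : ∀ x, x ∈ P ↔ x ∈ X ∧ x ∉ Y ∧ x ∉ nbhd T Y := by
    simp [P, closedNbhd]
  have hDY : ∀ d ∈ D, d ∉ Y := by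
    intro d hd hdY
    obtain ⟨-, -, x, hx, hxd⟩ := Finset.mem_filter.1 hd
    obtain ⟨-, h1, h2⟩ := (hPmem x).1 hx
    exact h2 (mem_nbhd.2 ⟨h1, d, hdY, hxd.symm⟩)
  have hDP : ∀ d ∈ D, f d ∈ P := by
    intro d hd
    obtain ⟨hdX, hdN, -⟩ := Finset.mem_filter.1 hd
    obtain ⟨h1, h2⟩ := hf d hdX
    refine (hPmem _).2 ⟨h1, fun h => hdN (mem_nbhd.2 ⟨hDY d hd, _, h, h2.symm⟩), fun h => ?_⟩
    obtain ⟨b, hb, hbd⟩ := hsurj (Finset.mem_coe.2 (Finset.mem_inter.2 ⟨h1, h⟩))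
    exact hDY d hd (hfinj (hB b hb).1 hdX hbd ▸ (hB b hb).2)
  have hcard : D.card ≤ P.card := Finset.card_le_card_of_injOn f hDP
    (hfinj.mono (Finset.coe_subset.2 (Finset.filter_subset _ _)))
  have hPne : P.Nonempty := by
    by_contra hP
    rw [Finset.not_nonempty_iff_eq_empty] at hP
    have h1 : (X \ Y).card ≤ (Y \ X).card := by
      have hXB : ∀ x ∈ X \ Y, x ∈ B := by
        intro x hx
        obtain ⟨hxX, hxY⟩ := Finset.mem_sdiff.1 hx
        by_contra hxB
        have : x ∈ P := (hPmem x).2 ⟨hxX, hxY, fun h => hxB (Finset.mem_inter.2 ⟨hxX, h⟩)⟩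
        simp [hP] at this
      refine Finset.card_le_card_of_injOn g (fun x hx => ?_) fun a ha b hb hab => ?_
      · obtain ⟨h1, h2⟩ := hB x (hXB x hx)
        exact Finset.mem_coe.2 (Finset.mem_sdiff.2 ⟨h2, (mem_nbhd.1 h1).1⟩)
      · exact hginj (Finset.mem_inter.1 (hXB a ha)).2 (Finset.mem_inter.1 (hXB b hb)).2 hab
    have h2 := Finset.card_sdiff_add_card_inter X Y
    have h3 := Finset.card_sdiff_add_card_inter Y X
    rw [Finset.inter_comm] at h3
    omega
  obtain ⟨x, hxP, hdeg⟩ := hT.exists_card_filter_adj_le_one hPne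
    (Finset.disjoint_left.2 fun v hv hvD =>
      (mem_nbhd.1 (Finset.mem_filter.1 hvD).1).1 ((hPmem v).1 hv).1) hcard
  obtain ⟨hxX, hxY, hxN⟩ := (hPmem x).1 hxP
  have hxadj : ∀ y ∈ Y, ¬T.Adj y x := fun y hy hyx => hxN (mem_nbhd.2 ⟨hxY, y, hy, hyx⟩)
  have hnew : ∀ v ∈ nbhd T (insert x Y), v ∉ nbhd T Y → v ∈ D.filter fun q => T.Adj x q := by
    intro v hv hvY
    obtain ⟨h1, u, hu, huv⟩ := mem_nbhd.1 hv
    rcases Finset.mem_insert.1 hu with rfl | hu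
    · exact Finset.mem_filter.2 ⟨Finset.mem_filter.2
        ⟨mem_nbhd.2 ⟨fun h => hXs hxX h huv, u, hxX, huv⟩, hvY, u, hxP, huv⟩, huv⟩
    · exact absurd (mem_nbhd.2 ⟨fun h => h1 (Finset.mem_insert_of_mem h), u, hu, huv⟩) hvY
  refine ⟨x, hxX, hxY, MatchesNbhd.mem_psi (f := fun v => if v ∈ nbhd T Y then g v else x)
    ⟨fun a ha b hb hab => ?_, fun v hv => ?_⟩ fun a ha b hb hab => ?_⟩
  · by_cases haY : a ∈ nbhd T Y <;> by_cases hbY : b ∈ nbhd T Y <;>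
      simp only [haY, hbY, if_true, if_false] at hab
    · exact hginj haY hbY hab
    · exact absurd (hab ▸ (hg a haY).1) hxY
    · exact absurd (hab ▸ (hg b hbY).1) hxY
    · exact Finset.card_le_one.1 hdeg a (hnew a ha haY) b (hnew b hb hbY)
  · by_cases hvY : v ∈ nbhd T Y
    · simp only [hvY, if_true]
      exact ⟨Finset.mem_insert_of_mem (hg v hvY).1, (hg v hvY).2⟩
    · simp only [hvY, if_false]
      exact ⟨Finset.mem_insert_self _ _, (Finset.mem_filter.1 (hnew v hv hvY)).2.symm⟩
  · rcases Finset.mem_insert.1 ha with rfl | haY <;> rcases Finset.mem_insert.1 hb with rfl | hbY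
    · exact hab.ne rfl
    · exact hxadj b hbY hab.symm
    · exact hxadj a haY hab
    · exact hYs haY hbY hab

theorem empty_mem_psi (G : SimpleGraph V) : ∅ ∈ Psi G :=
  MatchesNbhd.mem_psi (f := id) (by simp [MatchesNbhd, nbhd]) (by simp [IsStable])

/-- The family of local maximum stable sets of a forest forms a
greedoid on its vertex set. -/
theorem forest_psi_greedoid (T : SimpleGraph V) (hT : T.IsAcyclic) :
    IsGreedoidFam (Psi T) :=
  ⟨⟨∅, empty_mem_psi T⟩, accessibleFam_psi hT, exchangeFam_psi hT⟩
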